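/- (Factorization of the marginal likelihood for β = 0.) Let n ≥ 1 be an integer, let α > 0, γ, δ be real numbers with n > γ + 1, n > δ + 1, and n > γ + δ − 2α + 1, let x̄₁, x̄₂ ∈ ℝ, s₁, s₂ > 0, and r ∈ (−1,1). Let f(y | μ₁, μ₂, σ₁, σ₂, ρ) denote the bivariate normal likelihood given in the context. Then the five-fold integral ∫_{−1}^{1} ∫₀^∞ ∫₀^∞ ∫_ℝ ∫_ℝ f(y | μ₁, μ₂, σ₁, σ₂, ρ) σ₁^{γ−1} σ₂^{δ−1} · (1−ρ²)^{α−1} / B(1/2, α) dμ₁ dμ₂ dσ₁ dσ₂ dρ equals p_{γ,δ}(y₀) · B(1/2, α + (n−γ−δ−1)/2) ₂F₁( (n−γ−1)/2, (n−δ−1)/2; α + (n−γ−δ)/2; r² ) / B(1/2, α), where p_{γ,δ}(y₀) = 2^{(−γ−δ−4)/2} (π^{1−n}/n) (n s₁²)^{(1+γ−n)/2} (n s₂²)^{(1+δ−n)/2} Γ((n−γ−1)/2) Γ((n−δ−1)/2). -/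

import Mathlib

open MeasureTheory Real Set

/-- Pochhammer symbol (rising factorial) `(x)_m`. -/
noncomputable def poch (x : ℝ) (m : ℕ) : ℝ := (ascPochhammer ℝ m).eval x

/-- Confluent hypergeometric function `₁F₁(a; c; z)`. -/
noncomputable def oneF1 (a c z : ℝ) : ℝ :=
  ∑' m : ℕ, poch a m / (poch c m * (m.factorial : ℝ)) * z ^ m

/-- Gauss hypergeometric function `₂F₁(a, b; c; z)`. -/
noncomputable def twoF1 (a b c z : ℝ) : ℝ :=
  ∑' m : ℕ, poch a m * poch b m / (poch c m * (m.factorial : ℝ)) * z ^ m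

/-- Generalized hypergeometric function `₃F₂(a₁, a₂, a₃; b₁, b₂; z)`. -/
noncomputable def threeF2 (a₁ a₂ a₃ b₁ b₂ z : ℝ) : ℝ :=
  ∑' m : ℕ, poch a₁ m * poch a₂ m * poch a₃ m /
      (poch b₁ m * poch b₂ m * (m.factorial : ℝ)) * z ^ m

/-- Beta function `B(u,v) = Γ(u)Γ(v)/Γ(u+v)`. -/
noncomputable def betaFn (u v : ℝ) : ℝ := Real.Gamma u * Real.Gamma v / Real.Gamma (u + v)

/-- `W_{γ,δ}(n)`, the ratio of Gamma functions from the paper. -/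
noncomputable def Wgd (γ δ : ℝ) (n : ℕ) : ℝ :=
  (Real.Gamma (((n : ℝ) - γ) / 2) * Real.Gamma (((n : ℝ) - δ) / 2)) /
    (Real.Gamma (((n : ℝ) - γ - 1) / 2) * Real.Gamma (((n : ℝ) - δ - 1) / 2))

/-- The bivariate normal likelihood for data summarized by `y = (n, x̄₁, x̄₂, s₁, s₂, r)`. -/
noncomputable def biLik (n : ℕ) (x1 x2 s1 s2 r μ1 μ2 σ1 σ2 ρ : ℝ) : ℝ :=
  (2 * π * σ1 * σ2 * Real.sqrt (1 - ρ ^ 2)) ^ (-(n : ℝ)) *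
    Real.exp (-((n : ℝ) / (2 * (1 - ρ ^ 2))) *
      ((x1 - μ1) ^ 2 / σ1 ^ 2 - 2 * ρ * (x1 - μ1) * (x2 - μ2) / (σ1 * σ2) +
        (x2 - μ2) ^ 2 / σ2 ^ 2)) *
    Real.exp (-((n : ℝ) / (2 * (1 - ρ ^ 2))) *
      (s1 ^ 2 / σ1 ^ 2 - 2 * ρ * r * s1 * s2 / (σ1 * σ2) + s2 ^ 2 / σ2 ^ 2))

lemma integrableOn_rpow_mul_exp_neg_mul_sq_mul_exp {s x : ℝ} (hs : 0 < s) (hx : 0 < x) (y : ℝ) :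
    IntegrableOn (fun u : ℝ => u ^ (s - 1) * exp (-x * u ^ 2 + y * u)) (Ioi 0) := by
  have h := (integrableOn_rpow_mul_exp_neg_mul_sq (b := x / 2) (by positivity)
    (s := s - 1) (by linarith)).mul_const (exp (y ^ 2 / (2 * x)))
  refine h.mono' (by fun_prop) ?_
  filter_upwards [ae_restrict_mem measurableSet_Ioi] with u hu
  have hu0 : 0 < u := hu
  rw [Real.norm_of_nonneg (by positivity), mul_assoc, ← Real.exp_add]
  refine mul_le_mul_of_nonneg_left (Real.exp_le_exp.2 ?_) (by positivity)
  have : -(x / 2) * u ^ 2 + y ^ 2 / (2 * x) - (-x * u ^ 2 + y * u)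
      = (x * u - y) ^ 2 / (2 * x) := by field_simp; ring
  have h2 : 0 ≤ (x * u - y) ^ 2 / (2 * x) := by positivity
  linarith

lemma integral_rpow_mul_exp_neg_sq {s : ℝ} (hs : 0 < s) :
    ∫ u in Ioi (0 : ℝ), u ^ (s - 1) * exp (-u ^ 2) = Gamma (s / 2) / 2 := by
  have h := integral_rpow_mul_exp_neg_mul_rpow (p := 2) (q := s - 1) (b := 1) two_pos
    (by linarith) one_pos
  simp only [neg_mul, one_mul, rpow_two, sub_add_cancel, one_rpow] at h
  rw [h]; ring

lemma integrableOn_rpow_mul_exp_neg_sq {s : ℝ} (hs : 0 < s) :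
    IntegrableOn (fun u : ℝ => u ^ (s - 1) * exp (-u ^ 2)) (Ioi 0) := by
  simpa using integrableOn_rpow_mul_exp_neg_mul_sq (b := 1) one_pos (s := s - 1) (by linarith)

lemma hasSum_rpow_mul_exp_mul (a y u z : ℝ) (hu : 0 < u) :
    HasSum (fun k : ℕ => y ^ k / (k.factorial : ℝ) * (u ^ (a + k - 1) * exp z))
      (u ^ (a - 1) * exp (z + y * u)) := by
  have h := (NormedSpace.expSeries_div_hasSum_exp (y * u)).mul_left (u ^ (a - 1) * exp z)
  rw [← Real.exp_eq_exp_ℝ, mul_assoc, ← Real.exp_add] at h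
  refine h.congr_fun ?_
  intro k
  rw [show a + k - 1 = (a - 1) + k by ring, rpow_add hu, rpow_natCast, mul_pow]
  ring

/-- Termwise integration of the exponential series against `u ^ (a - 1) * exp (-u ^ 2)`. -/
lemma hasSum_integral_rpow_mul_exp_neg_sq_add {a : ℝ} (ha : 0 < a) (y : ℝ) :
    HasSum (fun k : ℕ => y ^ k / (k.factorial : ℝ) * (Gamma ((a + k) / 2) / 2))
      (∫ u in Ioi (0 : ℝ), u ^ (a - 1) * exp (-u ^ 2 + y * u)) := by
  have key := hasSum_integral_of_dominated_convergence (μ := volume.restrict (Ioi (0 : ℝ)))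
    (F := fun (k : ℕ) u => y ^ k / (k.factorial : ℝ) * (u ^ (a + k - 1) * exp (-u ^ 2)))
    (f := fun u => u ^ (a - 1) * exp (-u ^ 2 + y * u))
    (fun (k : ℕ) u => |y| ^ k / (k.factorial : ℝ) * (u ^ (a + k - 1) * exp (-u ^ 2)))
    (fun k => by fun_prop) ?_ ?_ ?_ ?_
  · refine key.congr_fun fun k => ?_
    rw [integral_const_mul, integral_rpow_mul_exp_neg_sq (by positivity)]
  · intro k
    filter_upwards [ae_restrict_mem measurableSet_Ioi] with u hu
    have hu0 : 0 < u := hu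
    rw [norm_mul, norm_div, norm_pow, Real.norm_eq_abs, Real.norm_natCast,
      Real.norm_of_nonneg (by positivity : 0 ≤ u ^ (a + k - 1) * exp (-u ^ 2))]
  · filter_upwards [ae_restrict_mem measurableSet_Ioi] with u hu
    exact (hasSum_rpow_mul_exp_mul a |y| u _ hu).summable
  · have h := integrableOn_rpow_mul_exp_neg_mul_sq_mul_exp ha one_pos |y|
    refine (integrableOn_congr_fun (fun u hu => ?_) measurableSet_Ioi).2 h
    simpa using (hasSum_rpow_mul_exp_mul a |y| u (-u ^ 2) hu).tsum_eq
  · filter_upwards [ae_restrict_mem measurableSet_Ioi] with u hu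
    exact hasSum_rpow_mul_exp_mul a y u _ hu

lemma integral_rpow_mul_exp_le {a t : ℝ} (ha : 0 < a) (ht0 : 0 ≤ t) (ht : t < 1) (v : ℝ) :
    ∫ u in Ioi (0 : ℝ), u ^ (a - 1) * exp (-u ^ 2 + 2 * t * v * u) ≤
      exp (t * v ^ 2) * ∫ u in Ioi (0 : ℝ), u ^ (a - 1) * exp (-(1 - t) * u ^ 2) := by
  rw [← integral_const_mul]
  refine setIntegral_mono_on ?_ ?_ measurableSet_Ioi fun u hu => ?_
  · simpa using integrableOn_rpow_mul_exp_neg_mul_sq_mul_exp ha one_pos (2 * t * v)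
  · exact (integrableOn_rpow_mul_exp_neg_mul_sq (b := 1 - t) (by linarith)
      (s := a - 1) (by linarith)).const_mul _
  · have hu0 : 0 < u := hu
    rw [mul_left_comm, ← Real.exp_add]
    refine mul_le_mul_of_nonneg_left (Real.exp_le_exp.2 ?_) (by positivity)
    nlinarith [mul_nonneg ht0 (sq_nonneg (u - v))]

lemma summable_pow_mul_Gamma_mul_Gamma {a b t : ℝ} (ha : 0 < a) (hb : 0 < b) (ht0 : 0 ≤ t)
    (ht : t < 1) :
    Summable (fun k : ℕ => (2 * t) ^ k / (k.factorial : ℝ) * (Gamma ((a + k) / 2) / 2) *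
      (Gamma ((b + k) / 2) / 2)) := by
  have hG : ∀ {c : ℝ}, 0 < c → ∀ k : ℕ, 0 < Gamma ((c + k) / 2) := fun hc k =>
    Gamma_pos_of_pos (by positivity)
  set G := ∫ u in Ioi (0 : ℝ), u ^ (a - 1) * exp (-(1 - t) * u ^ 2)
  refine summable_of_sum_range_le
    (c := G * ∫ v in Ioi (0 : ℝ), v ^ (b - 1) * exp (-(1 - t) * v ^ 2)) (fun k => ?_) fun N => ?_
  · have := hG ha k
    have := hG hb k
    positivity
  have hint : ∀ k : ℕ, IntegrableOn (fun v : ℝ => (2 * t) ^ k / (k.factorial : ℝ) *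
      (Gamma ((a + k) / 2) / 2) * (v ^ (b + k - 1) * exp (-v ^ 2))) (Ioi 0) := fun k =>
    (integrableOn_rpow_mul_exp_neg_sq (by positivity)).const_mul _
  have heq : ∀ k : ℕ, (2 * t) ^ k / (k.factorial : ℝ) * (Gamma ((a + k) / 2) / 2) *
      (Gamma ((b + k) / 2) / 2) = ∫ v in Ioi (0 : ℝ), (2 * t) ^ k / (k.factorial : ℝ) *
      (Gamma ((a + k) / 2) / 2) * (v ^ (b + k - 1) * exp (-v ^ 2)) := fun k => by
    rw [integral_const_mul, integral_rpow_mul_exp_neg_sq (by positivity)]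
  simp_rw [heq]
  rw [← integral_finsetSum _ fun k _ => hint k, ← integral_const_mul]
  refine setIntegral_mono_on (integrable_finsetSum _ fun k _ => hint k)
    ((integrableOn_rpow_mul_exp_neg_mul_sq (b := 1 - t) (by linarith)
      (s := b - 1) (by linarith)).const_mul _) measurableSet_Ioi fun v hv => ?_
  have hv0 : 0 < v := hv
  have h1 : ∑ k ∈ Finset.range N, (2 * t * v) ^ k / (k.factorial : ℝ) *
      (Gamma ((a + k) / 2) / 2) ≤
      ∫ u in Ioi (0 : ℝ), u ^ (a - 1) * exp (-u ^ 2 + 2 * t * v * u) :=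
    sum_le_hasSum _ (fun k _ => by have := hG ha k; positivity)
      (hasSum_integral_rpow_mul_exp_neg_sq_add ha (2 * t * v))
  have h2 := h1.trans (integral_rpow_mul_exp_le ha ht0 ht v)
  calc _ = v ^ (b - 1) * exp (-v ^ 2) * ∑ k ∈ Finset.range N, (2 * t * v) ^ k /
        (k.factorial : ℝ) * (Gamma ((a + k) / 2) / 2) := by
        rw [Finset.mul_sum]
        refine Finset.sum_congr rfl fun k _ => ?_
        rw [show b + k - 1 = (b - 1) + k by ring, rpow_add hv0, rpow_natCast, mul_pow _ v]
        ring
    _ ≤ v ^ (b - 1) * exp (-v ^ 2) * (exp (t * v ^ 2) * G) := by gcongr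
    _ = _ := by
        rw [show -(1 - t) * v ^ 2 = -v ^ 2 + t * v ^ 2 by ring, Real.exp_add]
        ring

lemma hasSum_integral_integral_rpow_mul_exp {a b t : ℝ} (ha : 0 < a) (hb : 0 < b) (ht : |t| < 1) :
    HasSum (fun k : ℕ => (2 * t) ^ k / (k.factorial : ℝ) * (Gamma ((a + k) / 2) / 2) *
      (Gamma ((b + k) / 2) / 2))
      (∫ v in Ioi (0 : ℝ), v ^ (b - 1) * exp (-v ^ 2) *
        ∫ u in Ioi (0 : ℝ), u ^ (a - 1) * exp (-u ^ 2 + 2 * t * v * u)) := by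
  have key := hasSum_integral_of_summable_integral_norm (μ := volume.restrict (Ioi (0 : ℝ)))
    (F := fun (k : ℕ) v => (2 * t) ^ k / (k.factorial : ℝ) * (Gamma ((a + k) / 2) / 2) *
      (v ^ (b + k - 1) * exp (-v ^ 2)))
    (fun k => (integrableOn_rpow_mul_exp_neg_sq (by positivity)).const_mul _) ?_
  · have heq : ∀ k : ℕ, (2 * t) ^ k / (k.factorial : ℝ) * (Gamma ((a + k) / 2) / 2) *
        (Gamma ((b + k) / 2) / 2) = ∫ v in Ioi (0 : ℝ), (2 * t) ^ k / (k.factorial : ℝ) *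
        (Gamma ((a + k) / 2) / 2) * (v ^ (b + k - 1) * exp (-v ^ 2)) := fun k => by
      rw [integral_const_mul, integral_rpow_mul_exp_neg_sq (by positivity)]
    simp_rw [heq]
    refine Eq.subst (motive := fun x => HasSum _ x) ?_ key
    refine setIntegral_congr_fun measurableSet_Ioi fun v hv => ?_
    have hv0 : 0 < v := hv
    refine HasSum.tsum_eq ?_
    refine ((hasSum_integral_rpow_mul_exp_neg_sq_add ha (2 * t * v)).mul_left
      (v ^ (b - 1) * exp (-v ^ 2))).congr_fun fun k => ?_
    rw [show b + k - 1 = (b - 1) + k by ring, rpow_add hv0, rpow_natCast, mul_pow _ v]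
    ring
  · refine (summable_pow_mul_Gamma_mul_Gamma ha hb (abs_nonneg t) ht).congr fun k => ?_
    have : 0 < Gamma ((a + k) / 2) := Gamma_pos_of_pos (by positivity)
    rw [← integral_rpow_mul_exp_neg_sq (by positivity : 0 < b + k), ← integral_const_mul]
    refine setIntegral_congr_fun measurableSet_Ioi fun v hv => ?_
    have hv0 : 0 < v := hv
    simp only [norm_mul, norm_div, norm_pow, Real.norm_eq_abs]
    simp [abs_of_pos this, abs_of_pos (rpow_pos_of_pos hv0 _)]

/-- The substitution `u = P / σ`. -/
lemma integral_rpow_mul_comp_div (h : ℝ → ℝ) (a : ℝ) {P : ℝ} (hP : 0 < P) :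
    ∫ σ in Ioi (0 : ℝ), σ ^ (-a - 1) * h (P / σ) =
      P ^ (-a) * ∫ u in Ioi (0 : ℝ), u ^ (a - 1) * h u := by
  have h1 := integral_comp_mul_left_Ioi (fun u => u ^ (a - 1) * h u) 0 hP
  have h2 := integral_comp_rpow_Ioi (fun x => (P * x) ^ (a - 1) * h (P * x))
    (p := -1) (by norm_num)
  rw [mul_zero] at h1
  rw [h1] at h2
  have hP' : P ^ (-a) = P ^ (1 - a) * P⁻¹ := by
    rw [← rpow_neg_one, ← rpow_add hP]; congr 1; ring
  rw [hP', mul_assoc, ← smul_eq_mul (P⁻¹), ← h2, ← integral_const_mul]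
  refine setIntegral_congr_fun measurableSet_Ioi fun σ hσ => ?_
  have hσ0 : 0 < σ := hσ
  simp only [smul_eq_mul, rpow_neg_one, ← div_eq_mul_inv]
  rw [div_rpow hP.le hσ0.le, show -a - 1 = (-1 - 1) - (a - 1) by ring, rpow_sub hσ0 (-1 - 1),
    show 1 - a = -(a - 1) by ring, rpow_neg hP.le]
  have := (rpow_pos_of_pos hP (a - 1)).ne'
  simp only [abs_neg, abs_one, one_mul]
  field_simp

lemma poch_mul_Gamma {x : ℝ} (hx : 0 < x) (m : ℕ) : poch x m * Gamma x = Gamma (x + m) := by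
  induction m with
  | zero => simp [poch]
  | succ m ih =>
    have h : poch x (m + 1) = poch x m * (x + m) := ascPochhammer_succ_eval m x
    rw [h, mul_right_comm, ih, Nat.cast_succ, ← add_assoc, Gamma_add_one (by positivity), mul_comm]

lemma factorial_two_mul_mul_sqrt_pi (m : ℕ) :
    ((2 * m).factorial : ℝ) * √π = 4 ^ m * (m.factorial : ℝ) * Gamma (m + 1 / 2) := by
  induction m with
  | zero => simpa using Gamma_one_half_eq.symm
  | succ m ih =>
    rw [show 2 * (m + 1) = 2 * m + 1 + 1 by ring, Nat.factorial_succ, Nat.factorial_succ,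
      Nat.factorial_succ, Nat.cast_succ, show (m : ℝ) + 1 + 1 / 2 = m + 1 / 2 + 1 by ring,
      Gamma_add_one (by positivity)]
    push_cast
    linear_combination (2 * (m : ℝ) + 1 + 1) * (2 * m + 1) * ih

lemma betaFn_pos {u v : ℝ} (hu : 0 < u) (hv : 0 < v) : 0 < betaFn u v :=
  ProbabilityTheory.beta_pos hu hv

lemma integral_rpow_mul_one_sub_rpow {u v : ℝ} (hu : 0 < u) (hv : 0 < v) :
    ∫ x in Ioo (0 : ℝ) 1, x ^ (u - 1) * (1 - x) ^ (v - 1) = betaFn u v := by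
  have h : betaFn u v = (Complex.betaIntegral u v).re :=
    ProbabilityTheory.beta_eq_betaIntegralReal u v hu hv
  have h2 : Complex.betaIntegral u v =
      ((∫ x in Ioo (0 : ℝ) 1, x ^ (u - 1) * (1 - x) ^ (v - 1) : ℝ) : ℂ) := by
    rw [Complex.betaIntegral, intervalIntegral.integral_of_le zero_le_one,
      integral_Ioc_eq_integral_Ioo, ← integral_complex_ofReal]
    refine setIntegral_congr_fun measurableSet_Ioo fun x hx => ?_
    have h1 : 0 ≤ 1 - x := by linarith [hx.2]
    rw [Complex.ofReal_mul, Complex.ofReal_cpow hx.1.le, Complex.ofReal_cpow h1]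
    push_cast
    rfl
  rw [h, h2, Complex.ofReal_re]

lemma integral_pow_even_mul_one_sub_sq_rpow (m : ℕ) {c : ℝ} (hc : 0 < c) :
    ∫ ρ in Ioo (-1 : ℝ) 1, ρ ^ (2 * m) * (1 - ρ ^ 2) ^ (c - 1) = betaFn (m + 1 / 2) c := by
  rw [← integral_rpow_mul_one_sub_rpow (by positivity) hc, ← integral_indicator measurableSet_Ioo]
  have h1 := integral_comp_abs
    (f := (Iio (1 : ℝ)).indicator fun ρ => ρ ^ (2 * m) * (1 - ρ ^ 2) ^ (c - 1))
  have h2 := integral_comp_rpow_Ioi_of_pos (p := 2)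
    (g := (Iio (1 : ℝ)).indicator fun x => x ^ ((m + 1 / 2 : ℝ) - 1) * (1 - x) ^ (c - 1)) two_pos
  rw [setIntegral_indicator measurableSet_Iio, Ioi_inter_Iio] at h2
  rw [← h2]
  calc _ = ∫ x : ℝ, (Iio (1 : ℝ)).indicator
        (fun ρ => ρ ^ (2 * m) * (1 - ρ ^ 2) ^ (c - 1)) |x| := by
        congr 1 with x
        simp only [indicator, mem_Ioo, mem_Iio, abs_lt, sq_abs, pow_mul]
    _ = _ := by
        rw [h1, ← integral_const_mul]
        refine setIntegral_congr_fun measurableSet_Ioi fun x hx => ?_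
        have hx0 : 0 < x := hx
        have hiff : x ^ 2 < 1 ↔ x < 1 := by
          rw [sq_lt_one_iff_abs_lt_one, abs_of_pos hx0]
        have hpow : x * (x ^ 2) ^ ((m + 1 / 2 : ℝ) - 1) = x ^ (2 * m) := by
          rw [← rpow_two, ← rpow_mul hx0.le, ← rpow_natCast]
          nth_rewrite 1 [← rpow_one x]
          rw [← rpow_add hx0]
          congr 1; push_cast; ring
        by_cases h : x < 1
        · simp only [indicator, mem_Iio, rpow_two, hiff, h, if_true, smul_eq_mul]
          rw [← hpow, show (2 : ℝ) - 1 = 1 by norm_num, rpow_one]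
          ring
        · simp [indicator, mem_Iio, hiff, h]

lemma integral_pow_odd_mul_one_sub_sq_rpow {k : ℕ} (hk : Odd k) (c : ℝ) :
    ∫ ρ in Ioo (-1 : ℝ) 1, ρ ^ k * (1 - ρ ^ 2) ^ c = 0 := by
  rw [← integral_indicator measurableSet_Ioo]
  have h := integral_neg_eq_self
    ((Ioo (-1 : ℝ) 1).indicator fun ρ => ρ ^ k * (1 - ρ ^ 2) ^ c) volume
  have h2 : ∀ x : ℝ, (Ioo (-1 : ℝ) 1).indicator (fun ρ => ρ ^ k * (1 - ρ ^ 2) ^ c) (-x) =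
      -(Ioo (-1 : ℝ) 1).indicator (fun ρ => ρ ^ k * (1 - ρ ^ 2) ^ c) x := fun x => by
    by_cases hx : x ∈ Ioo (-1 : ℝ) 1
    · rw [indicator_of_mem hx, 
        indicator_of_mem (show -x ∈ Ioo (-1 : ℝ) 1 from ⟨by linarith [hx.2], by linarith [hx.1]⟩),
        hk.neg_pow, neg_sq, neg_mul]
    · rw [indicator_of_notMem hx, indicator_of_notMem, neg_zero]
      exact fun h => hx ⟨by linarith [h.2], by linarith [h.1]⟩
  simp_rw [h2, integral_neg] at h
  linarith

lemma integrableOn_one_sub_sq_rpow {c : ℝ} (hc : 0 < c) :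
    IntegrableOn (fun ρ : ℝ => (1 - ρ ^ 2) ^ (c - 1)) (Ioo (-1) 1) := by
  by_contra h
  have h1 := integral_pow_even_mul_one_sub_sq_rpow 0 hc
  simp only [mul_zero, pow_zero, one_mul] at h1
  rw [integral_undef h] at h1
  exact (betaFn_pos (by positivity) hc).ne h1

lemma integral_exp_neg_mul_quadratic {c ρ x1 x2 σ1 σ2 : ℝ} (hσ1 : 0 < σ1) (hσ2 : 0 < σ2)
    (hc : 0 < c) (hρ : 0 < 1 - ρ ^ 2) :
    ∫ μ2 : ℝ, ∫ μ1 : ℝ, exp (-(c / (2 * (1 - ρ ^ 2))) *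
      ((x1 - μ1) ^ 2 / σ1 ^ 2 - 2 * ρ * (x1 - μ1) * (x2 - μ2) / (σ1 * σ2) +
        (x2 - μ2) ^ 2 / σ2 ^ 2)) = 2 * π * σ1 * σ2 * √(1 - ρ ^ 2) / c := by
  have h : ∀ μ1 μ2 : ℝ, exp (-(c / (2 * (1 - ρ ^ 2))) *
      ((x1 - μ1) ^ 2 / σ1 ^ 2 - 2 * ρ * (x1 - μ1) * (x2 - μ2) / (σ1 * σ2) +
        (x2 - μ2) ^ 2 / σ2 ^ 2)) = exp (-(c / (2 * σ2 ^ 2)) * (μ2 - x2) ^ 2) *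
      exp (-(c / (2 * (1 - ρ ^ 2) * σ1 ^ 2)) * (μ1 - (x1 - ρ * σ1 * (x2 - μ2) / σ2)) ^ 2) := by
    intro μ1 μ2
    rw [← Real.exp_add]
    congr 1
    field_simp
    ring
  have hg : ∀ b m : ℝ, ∫ x : ℝ, exp (-b * (x - m) ^ 2) = √(π / b) := fun b m => by
    rw [integral_sub_right_eq_self (fun x => exp (-b * x ^ 2)) m, integral_gaussian]
  simp_rw [h, integral_const_mul, hg, integral_mul_const, hg]
  rw [← sqrt_mul (by positivity), show π / (c / (2 * σ2 ^ 2)) *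
    (π / (c / (2 * (1 - ρ ^ 2) * σ1 ^ 2))) = (2 * π * σ1 * σ2 / c) ^ 2 * (1 - ρ ^ 2) by
      field_simp, sqrt_mul (by positivity), sqrt_sq (by positivity)]
  ring

lemma hasSum_integral_one_sub_sq_rpow_mul {a b c r : ℝ} (ha : 0 < a) (hb : 0 < b) (hc : 0 < c)
    (hr : |r| < 1) :
    HasSum (fun k : ℕ => (2 * r) ^ k / (k.factorial : ℝ) * (Gamma ((a + k) / 2) / 2) *
      (Gamma ((b + k) / 2) / 2) * ∫ ρ in Ioo (-1 : ℝ) 1, ρ ^ k * (1 - ρ ^ 2) ^ (c - 1))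
      (∫ ρ in Ioo (-1 : ℝ) 1, (1 - ρ ^ 2) ^ (c - 1) *
        ∫ v in Ioi (0 : ℝ), v ^ (b - 1) * exp (-v ^ 2) *
          ∫ u in Ioi (0 : ℝ), u ^ (a - 1) * exp (-u ^ 2 + 2 * (ρ * r) * v * u)) := by
  have hbound : ∀ (k : ℕ), ∀ ρ ∈ Ioo (-1 : ℝ) 1,
      ‖ρ ^ k * (1 - ρ ^ 2) ^ (c - 1)‖ ≤ (1 - ρ ^ 2) ^ (c - 1) := fun k ρ hρ => by
    have h1 : 0 < 1 - ρ ^ 2 := by nlinarith [hρ.1, hρ.2]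
    rw [norm_mul, norm_pow, Real.norm_of_nonneg (rpow_nonneg h1.le _)]
    exact mul_le_of_le_one_left (by positivity)
      (pow_le_one₀ (norm_nonneg _) (abs_le.2 ⟨hρ.1.le, hρ.2.le⟩))
  have hint : ∀ k : ℕ,
      IntegrableOn (fun ρ : ℝ => ρ ^ k * (1 - ρ ^ 2) ^ (c - 1)) (Ioo (-1) 1) := fun k => by
    refine (integrableOn_one_sub_sq_rpow hc).mono' (by fun_prop) ?_
    filter_upwards [ae_restrict_mem measurableSet_Ioo] with ρ hρ using hbound k ρ hρ
  have key := hasSum_integral_of_summable_integral_norm (μ := volume.restrict (Ioo (-1 : ℝ) 1))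
    (F := fun (k : ℕ) ρ => (2 * r) ^ k / (k.factorial : ℝ) * (Gamma ((a + k) / 2) / 2) *
      (Gamma ((b + k) / 2) / 2) * (ρ ^ k * (1 - ρ ^ 2) ^ (c - 1)))
    (fun k => (hint k).const_mul _) ?_
  · refine HasSum.congr_fun ?_ fun k => (integral_const_mul _ _).symm
    refine Eq.subst (motive := fun x => HasSum _ x) ?_ key
    refine setIntegral_congr_fun measurableSet_Ioo fun ρ hρ => ?_
    have hρr : |ρ * r| < 1 := by
      rw [abs_mul]
      exact mul_lt_one_of_nonneg_of_lt_one_right (abs_le.2 ⟨hρ.1.le, hρ.2.le⟩) (abs_nonneg r) hr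
    refine HasSum.tsum_eq ?_
    refine ((hasSum_integral_integral_rpow_mul_exp ha hb hρr).mul_left
      ((1 - ρ ^ 2) ^ (c - 1))).congr_fun fun k => ?_
    ring
  · refine Summable.of_nonneg_of_le (fun k => integral_nonneg fun ρ => norm_nonneg _) (fun k => ?_)
      ((summable_pow_mul_Gamma_mul_Gamma ha hb (abs_nonneg r) hr).mul_right
        (∫ ρ in Ioo (-1 : ℝ) 1, (1 - ρ ^ 2) ^ (c - 1)))
    have hGa : 0 < Gamma ((a + k) / 2) := Gamma_pos_of_pos (by positivity)
    have hGb : 0 < Gamma ((b + k) / 2) := Gamma_pos_of_pos (by positivity)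
    simp_rw [norm_mul _ (_ * _), integral_const_mul]
    have h1 : ‖(2 * r) ^ k / (k.factorial : ℝ) * (Gamma ((a + k) / 2) / 2) *
        (Gamma ((b + k) / 2) / 2)‖ = (2 * |r|) ^ k / (k.factorial : ℝ) *
        (Gamma ((a + k) / 2) / 2) * (Gamma ((b + k) / 2) / 2) := by
      simp [abs_of_pos hGa, abs_of_pos hGb]
    rw [h1]
    refine mul_le_mul_of_nonneg_left ?_ (by positivity)
    exact setIntegral_mono_on (hint k).norm (integrableOn_one_sub_sq_rpow hc) measurableSet_Ioo
      (hbound k)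

lemma integral_one_sub_sq_rpow_mul_eq_twoF1 {a b c r : ℝ} (ha : 0 < a) (hb : 0 < b) (hc : 0 < c)
    (hr : |r| < 1) :
    ∫ ρ in Ioo (-1 : ℝ) 1, (1 - ρ ^ 2) ^ (c - 1) *
        ∫ v in Ioi (0 : ℝ), v ^ (b - 1) * exp (-v ^ 2) *
          ∫ u in Ioi (0 : ℝ), u ^ (a - 1) * exp (-u ^ 2 + 2 * (ρ * r) * v * u) =
      Gamma (a / 2) * Gamma (b / 2) / 4 *
        (betaFn (1 / 2) c * twoF1 (a / 2) (b / 2) (c + 1 / 2) (r ^ 2)) := by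
  have h := hasSum_integral_one_sub_sq_rpow_mul ha hb hc hr
  rw [← Function.Injective.hasSum_iff (mul_right_injective₀ (two_ne_zero' ℕ))] at h
  · rw [← h.tsum_eq, twoF1, ← tsum_mul_left, ← tsum_mul_left]
    refine tsum_congr fun m => ?_
    have h1 := poch_mul_Gamma (half_pos ha) m
    have h2 := poch_mul_Gamma (half_pos hb) m
    have h3 := poch_mul_Gamma (by positivity : 0 < c + 1 / 2) m
    have h4 := factorial_two_mul_mul_sqrt_pi m
    have hm : (m.factorial : ℝ) ≠ 0 := by positivity
    have hG : Gamma (c + 1 / 2) ≠ 0 := (Gamma_pos_of_pos (by positivity)).ne'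
    have hG2 : Gamma (c + 1 / 2 + m) ≠ 0 := (Gamma_pos_of_pos (by positivity)).ne'
    have hp : poch (c + 1 / 2) m ≠ 0 := left_ne_zero_of_mul (h3 ▸ hG2)
    have h5 : Gamma ((m : ℝ) + 1 / 2) = ((2 * m).factorial : ℝ) * √π / (4 ^ m * m.factorial) := by
      rw [h4]; field_simp
    simp only [Function.comp_apply]
    rw [integral_pow_even_mul_one_sub_sq_rpow m hc, betaFn, betaFn, Gamma_one_half_eq, h5]
    push_cast
    rw [show (a + 2 * m) / 2 = a / 2 + m by ring, show (b + 2 * m) / 2 = b / 2 + m by ring,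
      show (m : ℝ) + 1 / 2 + c = c + 1 / 2 + m by ring, ← h1, ← h2, ← h3,
      show (1 : ℝ) / 2 + c = c + 1 / 2 by ring, pow_mul, mul_pow, mul_pow]
    field_simp
    ring
  · intro k hk
    have hodd : Odd k := by
      rw [← Nat.not_even_iff_odd]
      exact fun he => hk ((even_iff_exists_two_mul.1 he).imp fun _ h => h.symm)
    rw [integral_pow_odd_mul_one_sub_sq_rpow hodd, mul_zero]

lemma sqrt_div_mul_rpow_neg {n s D a : ℝ} (hn : 0 < n) (hs : 0 < s) (hD : 0 < D) :
    (√(n / (2 * D)) * s) ^ (-a) = (n * s ^ 2) ^ (-a / 2) * 2 ^ (a / 2) * D ^ (a / 2) := by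
  have h : √(n / (2 * D)) * s = (n * s ^ 2 / (2 * D)) ^ (1 / 2 : ℝ) := by
    rw [← sqrt_eq_rpow]
    nth_rewrite 1 [← sqrt_sq hs.le]
    rw [← sqrt_mul (by positivity)]
    congr 1; ring
  rw [h, ← rpow_mul (by positivity), show 1 / 2 * -a = -a / 2 by ring,
    div_rpow (by positivity) (by positivity), mul_rpow (by positivity : (0 : ℝ) ≤ 2) hD.le,
    show a / 2 = -(-a / 2) by ring, rpow_neg (by positivity : (0 : ℝ) ≤ 2) (-a / 2),
    rpow_neg hD.le (-a / 2)]
  field_simp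

lemma integral_integral_biLik {n : ℕ} (hn : 1 ≤ n) (x1 x2 s1 s2 r γ δ K : ℝ) {σ1 σ2 ρ : ℝ}
    (hσ1 : 0 < σ1) (hσ2 : 0 < σ2) (hρ : 0 < 1 - ρ ^ 2) :
    ∫ μ2 : ℝ, ∫ μ1 : ℝ,
        biLik n x1 x2 s1 s2 r μ1 μ2 σ1 σ2 ρ * σ1 ^ (γ - 1) * σ2 ^ (δ - 1) * K =
      (2 * π * √(1 - ρ ^ 2)) ^ (1 - (n : ℝ)) / n * K *
        (σ2 ^ (-((n : ℝ) - δ - 1) - 1) * (exp (-(√(n / (2 * (1 - ρ ^ 2))) * s2 / σ2) ^ 2) *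
          (σ1 ^ (-((n : ℝ) - γ - 1) - 1) * exp (-(√(n / (2 * (1 - ρ ^ 2))) * s1 / σ1) ^ 2 +
            2 * (ρ * r) * (√(n / (2 * (1 - ρ ^ 2))) * s2 / σ2) *
              (√(n / (2 * (1 - ρ ^ 2))) * s1 / σ1))))) := by
  have hn0 : (0 : ℝ) < n := by exact_mod_cast hn
  have hq : √((n : ℝ) / (2 * (1 - ρ ^ 2))) ^ 2 = n / (2 * (1 - ρ ^ 2)) := sq_sqrt (by positivity)
  have h : ∀ μ1 μ2 : ℝ,
      biLik n x1 x2 s1 s2 r μ1 μ2 σ1 σ2 ρ * σ1 ^ (γ - 1) * σ2 ^ (δ - 1) * K =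
      exp (-((n : ℝ) / (2 * (1 - ρ ^ 2))) *
        ((x1 - μ1) ^ 2 / σ1 ^ 2 - 2 * ρ * (x1 - μ1) * (x2 - μ2) / (σ1 * σ2) +
          (x2 - μ2) ^ 2 / σ2 ^ 2)) *
      ((2 * π * σ1 * σ2 * √(1 - ρ ^ 2)) ^ (-(n : ℝ)) *
        exp (-((n : ℝ) / (2 * (1 - ρ ^ 2))) *
          (s1 ^ 2 / σ1 ^ 2 - 2 * ρ * r * s1 * s2 / (σ1 * σ2) + s2 ^ 2 / σ2 ^ 2)) *
        σ1 ^ (γ - 1) * σ2 ^ (δ - 1) * K) := fun μ1 μ2 => by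
    rw [biLik]; ring
  have hexp : exp (-((n : ℝ) / (2 * (1 - ρ ^ 2))) *
      (s1 ^ 2 / σ1 ^ 2 - 2 * ρ * r * s1 * s2 / (σ1 * σ2) + s2 ^ 2 / σ2 ^ 2)) =
      exp (-(√(n / (2 * (1 - ρ ^ 2))) * s2 / σ2) ^ 2) *
        exp (-(√(n / (2 * (1 - ρ ^ 2))) * s1 / σ1) ^ 2 +
          2 * (ρ * r) * (√(n / (2 * (1 - ρ ^ 2))) * s2 / σ2) *
            (√(n / (2 * (1 - ρ ^ 2))) * s1 / σ1)) := by
    rw [← Real.exp_add]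
    congr 1
    linear_combination
      (s1 ^ 2 / σ1 ^ 2 - 2 * ρ * r * s1 * s2 / (σ1 * σ2) + s2 ^ 2 / σ2 ^ 2) * hq
  have hpow : 2 * π * σ1 * σ2 * √(1 - ρ ^ 2) * (2 * π * σ1 * σ2 * √(1 - ρ ^ 2)) ^ (-(n : ℝ)) =
      (2 * π * √(1 - ρ ^ 2)) ^ (1 - (n : ℝ)) * (σ1 ^ (1 - (n : ℝ)) * σ2 ^ (1 - (n : ℝ))) := by
    rw [← mul_rpow hσ1.le hσ2.le, ← mul_rpow (by positivity) (by positivity),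
      sub_eq_add_neg (1 : ℝ) n, rpow_add (by positivity), rpow_one]
    ring_nf
  have h1 : σ1 ^ (-((n : ℝ) - γ - 1) - 1) = σ1 ^ (1 - (n : ℝ)) * σ1 ^ (γ - 1) := by
    rw [← rpow_add hσ1]; congr 1; ring
  have h2 : σ2 ^ (-((n : ℝ) - δ - 1) - 1) = σ2 ^ (1 - (n : ℝ)) * σ2 ^ (δ - 1) := by
    rw [← rpow_add hσ2]; congr 1; ring
  simp_rw [h, integral_mul_const]
  rw [integral_exp_neg_mul_quadratic hσ1 hσ2 hn0 hρ, hexp, h1, h2]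
  linear_combination (exp (-(√(n / (2 * (1 - ρ ^ 2))) * s2 / σ2) ^ 2) *
        exp (-(√(n / (2 * (1 - ρ ^ 2))) * s1 / σ1) ^ 2 +
          2 * (ρ * r) * (√(n / (2 * (1 - ρ ^ 2))) * s2 / σ2) *
            (√(n / (2 * (1 - ρ ^ 2))) * s1 / σ1)) * σ1 ^ (γ - 1) * σ2 ^ (δ - 1) * K / n) * hpow

lemma integral_integral_integral_integral_biLik {n : ℕ} (hn : 1 ≤ n) (x1 x2 : ℝ) {s1 s2 : ℝ}
    (hs1 : 0 < s1) (hs2 : 0 < s2) (r α γ δ B : ℝ) {ρ : ℝ} (hρ : 0 < 1 - ρ ^ 2) :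
    ∫ σ2 in Ioi (0 : ℝ), ∫ σ1 in Ioi (0 : ℝ), ∫ μ2 : ℝ, ∫ μ1 : ℝ,
        biLik n x1 x2 s1 s2 r μ1 μ2 σ1 σ2 ρ * σ1 ^ (γ - 1) * σ2 ^ (δ - 1) *
          ((1 - ρ ^ 2) ^ (α - 1) / B) =
      (2 : ℝ) ^ (-(γ + δ) / 2) * (π ^ (1 - (n : ℝ)) / n) *
        ((n : ℝ) * s1 ^ 2) ^ ((1 + γ - (n : ℝ)) / 2) *
        ((n : ℝ) * s2 ^ 2) ^ ((1 + δ - (n : ℝ)) / 2) / B *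
        ((1 - ρ ^ 2) ^ (α + ((n : ℝ) - γ - δ - 1) / 2 - 1) *
          ∫ v in Ioi (0 : ℝ), v ^ ((n : ℝ) - δ - 1 - 1) * exp (-v ^ 2) *
            ∫ u in Ioi (0 : ℝ), u ^ ((n : ℝ) - γ - 1 - 1) *
              exp (-u ^ 2 + 2 * (ρ * r) * v * u)) := by
  have hn0 : (0 : ℝ) < n := by exact_mod_cast hn
  set P := √(n / (2 * (1 - ρ ^ 2))) * s1 with hP
  set Q := √(n / (2 * (1 - ρ ^ 2))) * s2 with hQ
  have hP0 : 0 < P := by positivity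
  have hQ0 : 0 < Q := by positivity
  have inner : ∀ σ2 ∈ Ioi (0 : ℝ), ∫ σ1 in Ioi (0 : ℝ), ∫ μ2 : ℝ, ∫ μ1 : ℝ,
        biLik n x1 x2 s1 s2 r μ1 μ2 σ1 σ2 ρ * σ1 ^ (γ - 1) * σ2 ^ (δ - 1) *
          ((1 - ρ ^ 2) ^ (α - 1) / B) =
      (2 * π * √(1 - ρ ^ 2)) ^ (1 - (n : ℝ)) / n * ((1 - ρ ^ 2) ^ (α - 1) / B) *
        P ^ (-((n : ℝ) - γ - 1)) * (σ2 ^ (-((n : ℝ) - δ - 1) - 1) * (exp (-(Q / σ2) ^ 2) *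
          ∫ u in Ioi (0 : ℝ), u ^ ((n : ℝ) - γ - 1 - 1) *
            exp (-u ^ 2 + 2 * (ρ * r) * (Q / σ2) * u))) := fun σ2 hσ2 => by
    rw [setIntegral_congr_fun measurableSet_Ioi fun σ1 hσ1 =>
      integral_integral_biLik hn x1 x2 s1 s2 r γ δ _ hσ1 hσ2 hρ]
    simp_rw [integral_const_mul]
    rw [integral_rpow_mul_comp_div (fun u => exp (-u ^ 2 + 2 * (ρ * r) * (Q / σ2) * u)) _ hP0]
    ring
  rw [setIntegral_congr_fun measurableSet_Ioi inner, integral_const_mul,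
    integral_rpow_mul_comp_div (fun v => exp (-v ^ 2) *
      ∫ u in Ioi (0 : ℝ), u ^ ((n : ℝ) - γ - 1 - 1) * exp (-u ^ 2 + 2 * (ρ * r) * v * u)) _ hQ0,
    hP, hQ, sqrt_div_mul_rpow_neg hn0 hs1 hρ, sqrt_div_mul_rpow_neg hn0 hs2 hρ]
  have h2 : (2 : ℝ) ^ (-(γ + δ) / 2) = 2 ^ (1 - (n : ℝ)) * 2 ^ (((n : ℝ) - γ - 1) / 2) *
      2 ^ (((n : ℝ) - δ - 1) / 2) := by
    rw [← rpow_add two_pos, ← rpow_add two_pos]; congr 1; ring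
  have hD : (1 - ρ ^ 2) ^ (α + ((n : ℝ) - γ - δ - 1) / 2 - 1) = √(1 - ρ ^ 2) ^ (1 - (n : ℝ)) *
      (1 - ρ ^ 2) ^ (α - 1) * (1 - ρ ^ 2) ^ (((n : ℝ) - γ - 1) / 2) *
      (1 - ρ ^ 2) ^ (((n : ℝ) - δ - 1) / 2) := by
    rw [sqrt_eq_rpow, ← rpow_mul hρ.le, ← rpow_add hρ, ← rpow_add hρ, ← rpow_add hρ]
    congr 1; ring
  rw [h2, hD, mul_rpow (by positivity) (sqrt_nonneg _), mul_rpow two_pos.le pi_pos.le,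
    show -((n : ℝ) - γ - 1) / 2 = (1 + γ - n) / 2 by ring,
    show -((n : ℝ) - δ - 1) / 2 = (1 + δ - n) / 2 by ring]
  simp_rw [mul_assoc (_ ^ ((n : ℝ) - δ - 1 - 1))]
  ring

/-- Factorization of the marginal likelihood for `β = 0`:
`p_η(y) = p_{γ,δ}(y₀) · p^{γ,δ}_α(n, r)`. -/
theorem marginal_likelihood_factorization (n : ℕ) (hn : 1 ≤ n) (α γ δ : ℝ) (hα : 0 < α)
    (hγ : γ + 1 < (n : ℝ)) (hδ : δ + 1 < (n : ℝ)) (hcond : γ + δ - 2 * α + 1 < (n : ℝ))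
    (x1 x2 s1 s2 : ℝ) (hs1 : 0 < s1) (hs2 : 0 < s2) (r : ℝ) (hr : r ∈ Ioo (-1 : ℝ) 1) :
    (∫ ρ in Ioo (-1 : ℝ) 1, ∫ σ2 in Ioi (0 : ℝ), ∫ σ1 in Ioi (0 : ℝ), ∫ μ2 : ℝ, ∫ μ1 : ℝ,
        biLik n x1 x2 s1 s2 r μ1 μ2 σ1 σ2 ρ * σ1 ^ (γ - 1) * σ2 ^ (δ - 1) *
          ((1 - ρ ^ 2) ^ (α - 1) / betaFn (1 / 2) α)) =
      ((2 : ℝ) ^ ((-γ - δ - 4) / 2) * (π ^ (1 - (n : ℝ)) / (n : ℝ)) *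
          ((n : ℝ) * s1 ^ 2) ^ ((1 + γ - (n : ℝ)) / 2) *
          ((n : ℝ) * s2 ^ 2) ^ ((1 + δ - (n : ℝ)) / 2) *
          Real.Gamma (((n : ℝ) - γ - 1) / 2) * Real.Gamma (((n : ℝ) - δ - 1) / 2)) *
        (betaFn (1 / 2) (α + ((n : ℝ) - γ - δ - 1) / 2) *
          twoF1 (((n : ℝ) - γ - 1) / 2) (((n : ℝ) - δ - 1) / 2)
            (α + ((n : ℝ) - γ - δ) / 2) (r ^ 2) / betaFn (1 / 2) α) := by
  have hr' : |r| < 1 := abs_lt.2 hr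
  have h4 : (2 : ℝ) ^ (-(γ + δ) / 2) = 2 ^ ((-γ - δ - 4) / 2) * 4 := by
    rw [show (4 : ℝ) = 2 ^ (2 : ℝ) by norm_num, ← rpow_add two_pos]; congr 1; norm_num; ring
  rw [setIntegral_congr_fun measurableSet_Ioo fun ρ hρ =>
      integral_integral_integral_integral_biLik hn x1 x2 hs1 hs2 r α γ δ _
        (show 0 < 1 - ρ ^ 2 by nlinarith [hρ.1, hρ.2]),
    integral_const_mul, integral_one_sub_sq_rpow_mul_eq_twoF1 (by linarith) (by linarith)
      (by linarith) hr', h4,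
    show α + ((n : ℝ) - γ - δ - 1) / 2 + 1 / 2 = α + ((n : ℝ) - γ - δ) / 2 by ring]
  ring
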